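/- arXiv:1902.09042 — 5 statements merged into one kernel-verified Lean document; each statement's English description precedes it below -/
import Mathlib

section
/- For all real polynomial functions φ and ψ, one has ⟨A_l φ, ψ⟩ = −⟨φ, A_l ψ⟩; that is, the difference operator A_l is anti-self-adjoint with respect to the symmetric inner product with weight ρ on the linear lattice ℤ. -/
open Polynomial Filter

/-- The symmetric inner product on the linear lattice `ℤ` with weight `ρ`:
`⟨φ,ψ⟩ = Σ_{x∈ℤ} φ(x)ψ(x)ρ(x)`. -/
noncomputable def linIP (ρ : ℤ → ℝ) (φ ψ : ℝ → ℝ) : ℝ :=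
  ∑' x : ℤ, φ x * ψ x * ρ x

/-- The difference operator `(A_l φ)(x) = g(x)φ(x+1) + f(x)(φ(x+1) − φ(x−1))`. -/
def Al (f g φ : ℝ → ℝ) : ℝ → ℝ :=
  fun x => g x * φ (x + 1) + f x * (φ (x + 1) - φ (x - 1))

/-- `A_l` is anti-self-adjoint for the symmetric inner product with
weight `ρ` on the linear lattice. -/
theorem linear_Al_antiselfadjoint
    (ρ : ℤ → ℝ) (hρ : ∀ x : ℤ, 0 ≤ ρ x) (f g : Polynomial ℝ)
    (hPearson : ∀ x : ℤ,
      f.eval ((x : ℝ) + 1) * ρ (x + 1) = (f.eval (x : ℝ) + g.eval (x : ℝ)) * ρ x)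
    (hSumF : ∀ P : Polynomial ℝ,
      Summable fun x : ℤ => |ρ x * f.eval (x : ℝ) * P.eval (x : ℝ)|)
    (hSumG : ∀ P : Polynomial ℝ,
      Summable fun x : ℤ => |ρ x * g.eval (x : ℝ) * P.eval (x : ℝ)|)
    (hSumρ : ∀ P : Polynomial ℝ,
      Summable fun x : ℤ => |ρ x * P.eval (x : ℝ)|)
    (hTendTop : ∀ P : Polynomial ℝ,
      Tendsto (fun x : ℤ => ρ x * f.eval (x : ℝ) * P.eval (x : ℝ)) atTop (nhds 0))
    (hTendBot : ∀ P : Polynomial ℝ,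
      Tendsto (fun x : ℤ => ρ x * f.eval (x : ℝ) * P.eval (x : ℝ)) atBot (nhds 0))
    (φ ψ : Polynomial ℝ) :
    linIP ρ (Al f.eval g.eval φ.eval) ψ.eval
      = - linIP ρ φ.eval (Al f.eval g.eval ψ.eval) := by
  have hF (P : ℝ[X]) : Summable fun x : ℤ => ρ x * f.eval (x : ℝ) * P.eval (x : ℝ) :=
    (hSumF P).of_abs
  have hG (P : ℝ[X]) : Summable fun x : ℤ => ρ x * g.eval (x : ℝ) * P.eval (x : ℝ) :=
    (hSumG P).of_abs
  have hA (p q : ℝ[X]) :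
      Summable fun x : ℤ => Al f.eval g.eval p.eval x * q.eval (x : ℝ) * ρ x := by
    refine ((hG (p.comp (X + 1) * q)).add
      (hF ((p.comp (X + 1) - p.comp (X - 1)) * q))).congr fun x => ?_
    simp only [Al, eval_mul, eval_sub, eval_comp, eval_add, eval_X, eval_one]
    ring
  have hψ : Summable fun x : ℤ => φ.eval (x : ℝ) * Al f.eval g.eval ψ.eval x * ρ x :=
    (hA ψ φ).congr fun x => by ring
  set h : ℤ → ℝ := fun x => ρ x * f.eval (x : ℝ) *
    (φ.comp (X - 1) * ψ + φ * ψ.comp (X - 1)).eval (x : ℝ) with h_def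
  have hh : Summable h := hF _
  have hshift : Summable fun x => h (x + 1) :=
    (Equiv.addRight (1 : ℤ)).summable_iff.mpr hh
  have htsum : ∑' x, h (x + 1) = ∑' x, h x := (Equiv.addRight (1 : ℤ)).tsum_eq h
  rw [eq_neg_iff_add_eq_zero, linIP, linIP, ← (hA φ ψ).tsum_add hψ,
    ← sub_eq_zero.mpr htsum, ← hshift.tsum_sub hh]
  refine tsum_congr fun x => ?_
  simp only [h_def, Al, eval_mul, eval_sub, eval_comp, eval_add, eval_X, eval_one, Int.cast_add,
    Int.cast_one, add_sub_cancel_right]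
  linear_combination
    -(φ.eval (x : ℝ) * ψ.eval ((x : ℝ) + 1) + φ.eval ((x : ℝ) + 1) * ψ.eval (x : ℝ)) * hPearson x
end

section
/- For all real polynomial functions φ and ψ, one has ⟨φ, A_l ψ⟩ = ⟨φ, ψ⟩_{s,ω}, where ω(x) = f(x+1)ρ(x+1); that is, pairing with A_l converts the symmetric inner product with weight ρ into the skew-symmetric inner product with weight f(x+1)ρ(x+1). -/
open Polynomial Filter

/-- The skew-symmetric inner product on the linear lattice `ℤ` with weight `ω`:
`⟨φ,ψ⟩_{s,ω} = Σ_{x∈ℤ} [φ(x)ψ(x+1) − φ(x+1)ψ(x)]ω(x)`. -/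
noncomputable def linSIP (ω : ℤ → ℝ) (φ ψ : ℝ → ℝ) : ℝ :=
  ∑' x : ℤ, (φ x * ψ (x + 1) - φ (x + 1) * ψ x) * ω x

/-- pairing with `A_l` turns the symmetric inner product with weight `ρ`
into the skew-symmetric inner product with weight `ω(x) = f(x+1)ρ(x+1)`. -/
theorem linear_Al_skew_symmetrisation
    (ρ : ℤ → ℝ) (hρ : ∀ x : ℤ, 0 ≤ ρ x) (f g : Polynomial ℝ)
    (hPearson : ∀ x : ℤ,
      f.eval ((x : ℝ) + 1) * ρ (x + 1) = (f.eval (x : ℝ) + g.eval (x : ℝ)) * ρ x)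
    (hSumF : ∀ P : Polynomial ℝ,
      Summable fun x : ℤ => |ρ x * f.eval (x : ℝ) * P.eval (x : ℝ)|)
    (hSumG : ∀ P : Polynomial ℝ,
      Summable fun x : ℤ => |ρ x * g.eval (x : ℝ) * P.eval (x : ℝ)|)
    (hSumρ : ∀ P : Polynomial ℝ,
      Summable fun x : ℤ => |ρ x * P.eval (x : ℝ)|)
    (hTendTop : ∀ P : Polynomial ℝ,
      Tendsto (fun x : ℤ => ρ x * f.eval (x : ℝ) * P.eval (x : ℝ)) atTop (nhds 0))
    (hTendBot : ∀ P : Polynomial ℝ,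
      Tendsto (fun x : ℤ => ρ x * f.eval (x : ℝ) * P.eval (x : ℝ)) atBot (nhds 0))
    (φ ψ : Polynomial ℝ) :
    linIP ρ φ.eval (Al f.eval g.eval ψ.eval)
      = linSIP (fun x : ℤ => f.eval ((x : ℝ) + 1) * ρ (x + 1)) φ.eval ψ.eval := by
  have hb : Summable fun x : ℤ => φ.eval (x : ℝ) * ψ.eval ((x : ℝ) - 1) * f.eval (x : ℝ) * ρ x :=
    (hSumF (φ * ψ.comp (X - 1))).of_abs.congr fun x => by
      simp only [eval_mul, eval_comp, eval_sub, eval_X, eval_one]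
      ring
  have ha : Summable fun x : ℤ =>
      φ.eval (x : ℝ) * ψ.eval ((x : ℝ) + 1) * (f.eval ((x : ℝ) + 1) * ρ (x + 1)) :=
    ((hSumF (φ * ψ.comp (X + 1))).of_abs.add (hSumG (φ * ψ.comp (X + 1))).of_abs).congr
      fun x => by
        simp only [eval_mul, eval_comp, eval_add, eval_X, eval_one, hPearson]
        ring
  have hshift := (Equiv.addRight (1 : ℤ)).tsum_eq
    fun x : ℤ => φ.eval (x : ℝ) * ψ.eval ((x : ℝ) - 1) * f.eval (x : ℝ) * ρ x
  have hb' := (Equiv.addRight (1 : ℤ)).summable_iff.mpr hb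
  simp only [Function.comp_def, Equiv.coe_addRight, Int.cast_add, Int.cast_one,
    add_sub_cancel_right] at hshift hb'
  calc linIP ρ φ.eval (Al f.eval g.eval ψ.eval)
      = ∑' x : ℤ, (φ.eval (x : ℝ) * ψ.eval ((x : ℝ) + 1) * (f.eval ((x : ℝ) + 1) * ρ (x + 1))
          - φ.eval (x : ℝ) * ψ.eval ((x : ℝ) - 1) * f.eval (x : ℝ) * ρ x) :=
        tsum_congr fun x => by
          rw [hPearson, Al]
          ring
    _ = ∑' x : ℤ, (φ.eval (x : ℝ) * ψ.eval ((x : ℝ) + 1) * (f.eval ((x : ℝ) + 1) * ρ (x + 1))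
          - φ.eval ((x : ℝ) + 1) * ψ.eval (x : ℝ) * f.eval ((x : ℝ) + 1) * ρ (x + 1)) := by
        rw [ha.tsum_sub hb, ha.tsum_sub hb', hshift]
    _ = linSIP (fun x : ℤ => f.eval ((x : ℝ) + 1) * ρ (x + 1)) φ.eval ψ.eval :=
        tsum_congr fun x => by ring
end

section
/- There exists a sequence of real constants c_n (n ≥ 0; set c_{−1} = 0) such that for every n ≥ 0 one has the identity of polynomials A_l p_n = −(c_n/h_{n+1}) p_{n+1} + (c_{n−1}/h_{n−1}) p_{n−1}; i.e., the operator A_l acts tridiagonally (with vanishing diagonal) on the monic orthogonal polynomials for a classical discrete weight. -/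
open Polynomial Filter

/-- The linear functional `P ↦ Σ_{x∈ℤ} P(x)ρ(x)` of a weight with absolutely summable moments. -/
noncomputable def weightFunctional (ρ : ℤ → ℝ)
    (hρ : ∀ P : Polynomial ℝ, Summable fun x : ℤ => |ρ x * P.eval (x : ℝ)|) :
    Polynomial ℝ →ₗ[ℝ] ℝ where
  toFun P := ∑' x : ℤ, ρ x * P.eval (x : ℝ)
  map_add' P Q := by
    simp only [eval_add, mul_add]
    exact (hρ P).of_abs.tsum_add (hρ Q).of_abs
  map_smul' a P := by
    simp only [eval_smul, smul_eq_mul, RingHom.id_apply, mul_left_comm _ a]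
    exact tsum_mul_left

/-- The operator `Al` on polynomials. -/
noncomputable def AlPoly (f g P : Polynomial ℝ) : Polynomial ℝ :=
  g * P.comp (X + C 1) + f * (P.comp (X + C 1) - P.comp (X - C 1))

theorem eval_AlPoly (f g P : Polynomial ℝ) (x : ℝ) :
    (AlPoly f g P).eval x = Al f.eval g.eval P.eval x := by
  simp [AlPoly, Al, eval_comp]

theorem degree_AlPoly_lt {f g P : Polynomial ℝ} (hf : f.natDegree ≤ 2) (hg : g.natDegree ≤ 1)
    (hP : P.Monic) : (AlPoly f g P).degree < ((P.natDegree + 2 : ℕ) : WithBot ℕ) := by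
  have hadd := hP.comp_X_add_C 1
  have hsub := hP.comp_X_sub_C 1
  have nadd : (P.comp (X + C 1)).natDegree = P.natDegree := by
    simp only [natDegree_comp, natDegree_X_add_C, mul_one]
  have nsub : (P.comp (X - C 1)).natDegree = P.natDegree := by
    simp only [natDegree_comp, natDegree_X_sub_C, mul_one]
  have hD : (P.comp (X + C 1) - P.comp (X - C 1)).degree < (P.natDegree : WithBot ℕ) := by
    have key := degree_sub_lt_left (p := P.comp (X + C 1)) (q := P.comp (X - C 1))
      (by rw [degree_eq_natDegree hadd.ne_zero, degree_eq_natDegree hsub.ne_zero, nadd, nsub])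
      hadd.ne_zero (by rw [hadd.leadingCoeff, hsub.leadingCoeff])
    rwa [degree_eq_natDegree hadd.ne_zero, nadd] at key
  refine lt_of_le_of_lt (degree_add_le _ _) (max_lt ?_ ?_)
  · refine lt_of_le_of_lt degree_le_natDegree ?_
    have := natDegree_mul_le (p := g) (q := P.comp (X + C 1))
    rw [nadd] at this
    exact_mod_cast (by lia)
  · by_cases h0 : P.comp (X + C 1) - P.comp (X - C 1) = 0
    · simp only [h0, mul_zero, degree_zero]
      exact WithBot.bot_lt_coe _
    · rw [degree_eq_natDegree h0] at hD
      have hD' := WithBot.coe_lt_coe.mp hD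
      refine lt_of_le_of_lt degree_le_natDegree ?_
      have := natDegree_mul_le (p := f) (q := P.comp (X + C 1) - P.comp (X - C 1))
      exact_mod_cast (by simp only [Nat.cast_id] at hD'; lia)

/-- Under the Pearson equation the operator `Al` is skew-symmetric. -/
theorem weightFunctional_AlPoly_mul_skew {ρ : ℤ → ℝ} {f g : Polynomial ℝ}
    (hPearson : ∀ x : ℤ,
      f.eval ((x : ℝ) + 1) * ρ (x + 1) = (f.eval (x : ℝ) + g.eval (x : ℝ)) * ρ x)
    (hSumF : ∀ P : Polynomial ℝ,
      Summable fun x : ℤ => |ρ x * f.eval (x : ℝ) * P.eval (x : ℝ)|)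
    (hρ : ∀ P : Polynomial ℝ, Summable fun x : ℤ => |ρ x * P.eval (x : ℝ)|)
    (P Q : Polynomial ℝ) :
    weightFunctional ρ hρ (AlPoly f g P * Q) = -weightFunctional ρ hρ (AlPoly f g Q * P) := by
  have key : ∀ P Q : Polynomial ℝ, weightFunctional ρ hρ (AlPoly f g P * Q) =
      (∑' x : ℤ, ρ x * f.eval (x : ℝ) * (P * Q.comp (X - C 1)).eval (x : ℝ)) -
        ∑' x : ℤ, ρ x * f.eval (x : ℝ) * (Q * P.comp (X - C 1)).eval (x : ℝ) := by
    intro P Q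
    have hs := (hSumF (P * Q.comp (X - C 1))).of_abs
    rw [← (Equiv.addRight (1 : ℤ)).tsum_eq
      (fun x : ℤ => ρ x * f.eval (x : ℝ) * (P * Q.comp (X - C 1)).eval (x : ℝ))]
    refine Eq.trans ?_ (Summable.tsum_sub ((Equiv.addRight (1 : ℤ)).summable_iff.mpr hs)
      (hSumF (Q * P.comp (X - C 1))).of_abs)
    refine tsum_congr fun x => ?_
    simp only [AlPoly, Equiv.coe_addRight, eval_mul, eval_add, eval_sub,
      eval_comp, eval_X, eval_C, Int.cast_add, Int.cast_one, add_sub_cancel_right]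
    linear_combination -(P.eval ((x : ℝ) + 1) * Q.eval (x : ℝ)) * hPearson x
  rw [key P Q, key Q P, neg_sub]

theorem degree_sub_coeff_mul_lt {p r : Polynomial ℝ} {N : ℕ} (hp : p.Monic)
    (hN : p.natDegree = N) (hr : r.degree < ((N + 1 : ℕ) : WithBot ℕ)) :
    (r - r.coeff N • p).degree < (N : WithBot ℕ) := by
  rw [degree_lt_iff_coeff_zero] at hr ⊢
  intro m hm
  rcases hm.eq_or_lt with rfl | hm
  · have : p.coeff N = 1 := hN ▸ hp.coeff_natDegree
    simp [this]
  · simp [hr m hm, coeff_eq_zero_of_natDegree_lt (hN ▸ hm : p.natDegree < m)]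

section OrthogonalPolynomials

variable {L : Polynomial ℝ →ₗ[ℝ] ℝ} {p : ℕ → Polynomial ℝ} {h : ℕ → ℝ}

theorem map_mul_eq_zero_of_degree_lt (hmonic : ∀ n, (p n).Monic)
    (hdeg : ∀ n, (p n).natDegree = n)
    (horth : ∀ n m, L (p n * p m) = if n = m then h n else 0) {k : ℕ} (N : ℕ) (hN : N ≤ k)
    (r : Polynomial ℝ) (hr : r.degree < (N : WithBot ℕ)) : L (r * p k) = 0 := by
  induction N generalizing r with
  | zero =>
    have : r = 0 := by simpa [degree_lt_iff_coeff_zero, Polynomial.ext_iff] using hr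
    simp [this]
  | succ N ih =>
    have := ih (by lia) _ (degree_sub_coeff_mul_lt (hmonic N) (hdeg N) hr)
    rwa [sub_mul, smul_mul_assoc, map_sub, map_smul, horth, if_neg (by lia), smul_zero,
      sub_zero] at this

theorem eq_zero_of_map_mul_eq_zero (hmonic : ∀ n, (p n).Monic)
    (hdeg : ∀ n, (p n).natDegree = n) (hne : ∀ n, h n ≠ 0)
    (horth : ∀ n m, L (p n * p m) = if n = m then h n else 0) (N : ℕ)
    (r : Polynomial ℝ) (hr : r.degree < (N : WithBot ℕ)) (hL : ∀ k < N, L (r * p k) = 0) :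
    r = 0 := by
  induction N generalizing r with
  | zero => simpa [degree_lt_iff_coeff_zero, Polynomial.ext_iff] using hr
  | succ N ih =>
    have hs : r - r.coeff N • p N = 0 := by
      refine ih _ (degree_sub_coeff_mul_lt (hmonic N) (hdeg N) hr) fun k hk => ?_
      rw [sub_mul, smul_mul_assoc, map_sub, map_smul, horth, if_neg (by lia), hL k (by lia),
        smul_zero, sub_zero]
    have hc := hL N (by lia)
    rw [sub_eq_zero] at hs
    rw [hs, smul_mul_assoc, map_smul, horth, if_pos rfl, smul_eq_mul] at hc
    rw [hs, (mul_eq_zero.mp hc).resolve_right (hne N), zero_smul]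

end OrthogonalPolynomials

/-- for a classical discrete weight, `A_l` acts tridiagonally (with zero
diagonal) on the monic orthogonal polynomials:
`A_l p_n = −(c_n/h_{n+1}) p_{n+1} + (c_{n−1}/h_{n−1}) p_{n−1}` (with `c_{−1} = 0`). -/
theorem linear_Al_tridiagonal_action
    (ρ : ℤ → ℝ) (hρ : ∀ x : ℤ, 0 ≤ ρ x) (f g : Polynomial ℝ)
    (hPearson : ∀ x : ℤ,
      f.eval ((x : ℝ) + 1) * ρ (x + 1) = (f.eval (x : ℝ) + g.eval (x : ℝ)) * ρ x)
    (hf : f.natDegree ≤ 2) (hg : g.natDegree ≤ 1)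
    (hSumF : ∀ P : Polynomial ℝ,
      Summable fun x : ℤ => |ρ x * f.eval (x : ℝ) * P.eval (x : ℝ)|)
    (hSumG : ∀ P : Polynomial ℝ,
      Summable fun x : ℤ => |ρ x * g.eval (x : ℝ) * P.eval (x : ℝ)|)
    (hSumρ : ∀ P : Polynomial ℝ,
      Summable fun x : ℤ => |ρ x * P.eval (x : ℝ)|)
    (hTendTop : ∀ P : Polynomial ℝ,
      Tendsto (fun x : ℤ => ρ x * f.eval (x : ℝ) * P.eval (x : ℝ)) atTop (nhds 0))
    (hTendBot : ∀ P : Polynomial ℝ,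
      Tendsto (fun x : ℤ => ρ x * f.eval (x : ℝ) * P.eval (x : ℝ)) atBot (nhds 0))
    (p : ℕ → Polynomial ℝ) (hmonic : ∀ n, (p n).Monic) (hdeg : ∀ n, (p n).natDegree = n)
    (h : ℕ → ℝ) (hne : ∀ n, h n ≠ 0)
    (horth : ∀ n m, linIP ρ (p n).eval (p m).eval = if n = m then h n else 0) :
    ∃ c : ℕ → ℝ, ∀ (n : ℕ) (x : ℝ),
      Al f.eval g.eval (p n).eval x
        = -(c n / h (n + 1)) * (p (n + 1)).eval x
          + if n = 0 then 0 else c (n - 1) / h (n - 1) * (p (n - 1)).eval x := by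
  have hL : ∀ n m, weightFunctional ρ hSumρ (p n * p m) = if n = m then h n else 0 := by
    intro n m
    rw [← horth]
    refine tsum_congr fun x => ?_
    rw [eval_mul, mul_comm]
  have hA (n : ℕ) : (AlPoly f g (p n)).degree < ((n + 2 : ℕ) : WithBot ℕ) := by
    simpa only [hdeg] using degree_AlPoly_lt hf hg (hmonic n)
  have hskew (P Q : Polynomial ℝ) :=
    weightFunctional_AlPoly_mul_skew hPearson hSumF hSumρ P Q
  set L := weightFunctional ρ hSumρ
  have hdp (k N : ℕ) (hk : k < N) : (p k).degree < (N : WithBot ℕ) := by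
    rw [degree_eq_natDegree (hmonic k).ne_zero, hdeg]
    exact_mod_cast hk
  let c : ℕ → ℝ := fun n => -L (AlPoly f g (p n) * p (n + 1))
  let lower : ℕ → Polynomial ℝ := fun n =>
    if n = 0 then 0 else (c (n - 1) / h (n - 1)) • p (n - 1)
  have hlower (n k : ℕ) : L (lower n * p k) = if n = k + 1 then c k else 0 := by
    rcases n with _ | n
    · simp [lower]
    · simp only [lower, Nat.add_eq_zero_iff, one_ne_zero, and_false, if_false,
        Nat.add_sub_cancel, smul_mul_assoc, map_smul, hL, smul_eq_mul, add_left_inj]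
      split_ifs with hnk
      · subst hnk
        exact div_mul_cancel₀ _ (hne n)
      · rw [mul_zero]
  have hmain (n : ℕ) :
      AlPoly f g (p n) - (-(c n / h (n + 1)) • p (n + 1) + lower n) = 0 := by
    refine eq_zero_of_map_mul_eq_zero hmonic hdeg hne hL (n + 2) _ ?_ fun k hk => ?_
    · rw [← mem_degreeLT]
      refine sub_mem (mem_degreeLT.mpr (hA n)) (add_mem (Submodule.smul_mem _ _
        (mem_degreeLT.mpr (hdp _ _ (by lia)))) ?_)
      dsimp only [lower]
      split_ifs
      · exact zero_mem _
      · exact Submodule.smul_mem _ _ (mem_degreeLT.mpr (hdp _ _ (by lia)))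
    · rw [sub_mul, add_mul, smul_mul_assoc, map_sub, map_add, map_smul, hL, hlower, smul_eq_mul]
      obtain rfl | rfl | rfl | hlt : k = n + 1 ∨ k = n ∨ n = k + 1 ∨ k + 1 < n := by lia
      · rw [if_pos rfl, if_neg (by lia), neg_mul, div_mul_cancel₀ _ (hne _)]
        simp [c]
      · rw [if_neg (by lia), if_neg (by lia)]
        linarith [hskew (p k) (p k)]
      · rw [if_neg (by lia), if_pos rfl, hskew]
        simp [c]
      · rw [if_neg (by lia), if_neg (by lia), hskew,
          map_mul_eq_zero_of_degree_lt hmonic hdeg hL (k + 2) (by lia) _ (hA k)]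
        simp
  refine ⟨c, fun n x => ?_⟩
  rw [← eval_AlPoly, sub_eq_zero.mp (hmain n), eval_add, eval_smul, smul_eq_mul]
  dsimp only [lower]
  split_ifs
  · rw [eval_zero]
  · rw [eval_smul, smul_eq_mul]
end

section
/- For all real polynomial functions φ and ψ, one has ⟨A_q φ, ψ⟩ = −⟨φ, A_q ψ⟩; that is, the operator A_q is anti-self-adjoint with respect to the symmetric inner product with weight ρ on the exponential lattice. -/
open Polynomial Filter

/-- The `q`-difference operator `(D_q φ)(x) = (φ(x) − φ(qx))/((1−q)x)`. -/
noncomputable def Dq (q : ℝ) (φ : ℝ → ℝ) : ℝ → ℝ :=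
  fun x => (φ x - φ (q * x)) / ((1 - q) * x)

/-- The `q⁻¹`-difference operator `(D_{q⁻¹} φ)(x) = (φ(x) − φ(x/q))/((1−q⁻¹)x)`. -/
noncomputable def Dqinv (q : ℝ) (φ : ℝ → ℝ) : ℝ → ℝ :=
  fun x => (φ x - φ (x / q)) / ((1 - q⁻¹) * x)

/-- The operator `(A_q φ)(x) = q^{−1/2} g(x)φ(qx) + q⁻¹ f(x)(D_{q⁻¹}φ)(x) + f(x)(D_qφ)(x)`. -/
noncomputable def Aq (q : ℝ) (f g φ : ℝ → ℝ) : ℝ → ℝ :=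
  fun x => (Real.sqrt q)⁻¹ * g x * φ (q * x) + q⁻¹ * f x * Dqinv q φ x + f x * Dq q φ x

/-- The symmetric inner product on the exponential lattice `{qⁿ : n ∈ ℤ}`:
`⟨φ,ψ⟩ = (1−q) Σ_{n∈ℤ} qⁿ φ(qⁿ)ψ(qⁿ)ρ(qⁿ)`. -/
noncomputable def qIP (q : ℝ) (ρ φ ψ : ℝ → ℝ) : ℝ :=
  (1 - q) * ∑' n : ℤ, q ^ n * φ (q ^ n) * ψ (q ^ n) * ρ (q ^ n)

/-- The skew-symmetric inner product on the exponential lattice with weight `ω`: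
`⟨φ,ψ⟩_{s,ω} = (1−q) Σ_{n∈ℤ} qⁿ [φ(qⁿ)(D_qψ)(qⁿ) − ψ(qⁿ)(D_qφ)(qⁿ)]ω(qⁿ)`. -/
noncomputable def qSIP (q : ℝ) (ω φ ψ : ℝ → ℝ) : ℝ :=
  (1 - q) * ∑' n : ℤ,
    q ^ n * (φ (q ^ n) * Dq q ψ (q ^ n) - ψ (q ^ n) * Dq q φ (q ^ n)) * ω (q ^ n)

/-- A summable family over `ℤ` that telescopes a sequence vanishing at `±∞` has sum zero. -/
theorem tsum_int_sub_succ_eq_zero {W : ℤ → ℝ} (hs : Summable fun n => W n - W (n + 1))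
    (htop : Tendsto W atTop (nhds 0)) (hbot : Tendsto W atBot (nhds 0)) :
    ∑' n : ℤ, (W n - W (n + 1)) = 0 := by
  have hsets : Tendsto (fun N : ℕ => Finset.Ico (-(N : ℤ)) N) atTop atTop := by
    refine tendsto_atTop_finset_of_monotone ?_ ?_
    · intro a b hab
      apply Finset.Ico_subset_Ico <;> lia
    · intro x
      exact ⟨x.natAbs + 1, by rw [Finset.mem_Ico]; lia⟩
  have hpartial (N : ℕ) :
      ∑ n ∈ Finset.Ico (-(N : ℤ)) N, (W n - W (n + 1)) = W (-(N : ℤ)) - W N := by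
    induction N with
    | zero => simp
    | succ N ih =>
      have hIco : Finset.Ico (-((N + 1 : ℕ) : ℤ)) ((N + 1 : ℕ) : ℤ)
          = insert (-(N : ℤ) - 1) (insert (N : ℤ) (Finset.Ico (-(N : ℤ)) N)) := by
        ext x
        simp only [Finset.mem_Ico, Finset.mem_insert]
        lia
      rw [hIco, Finset.sum_insert (by simp only [Finset.mem_Ico, Finset.mem_insert]; lia),
        Finset.sum_insert (by simp), ih]
      have h : -((N + 1 : ℕ) : ℤ) = -(N : ℤ) - 1 := by lia
      rw [h, sub_add_cancel]
      push_cast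
      ring
  have hlim : Tendsto (fun N : ℕ => W (-(N : ℤ)) - W N) atTop (nhds (0 - 0)) :=
    (hbot.comp (tendsto_neg_atTop_atBot.comp tendsto_natCast_atTop_atTop)).sub
      (htop.comp tendsto_natCast_atTop_atTop)
  have hsum := hs.hasSum.comp hsets
  simp only [Function.comp_def, hpartial] at hsum
  simpa using tendsto_nhds_unique hsum hlim

/-- The difference of two dilations of a polynomial is divisible by `X`. -/
theorem exists_eval_mul_sub_eval_mul (P : Polynomial ℝ) (a b : ℝ) :
    ∃ R : Polynomial ℝ, ∀ x, P.eval (a * x) - P.eval (b * x) = x * R.eval x := by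
  have h : X ∣ P.comp (C a * X) - P.comp (C b * X) := by
    rw [X_dvd_iff, coeff_zero_eq_eval_zero]
    simp
  obtain ⟨R, hR⟩ := h
  exact ⟨R, fun x => by simpa using congrArg (eval x) hR⟩

/-- The lattice terms of `⟨A_q φ, ψ⟩` are absolutely summable. -/
theorem summable_mul_Aq_mul {q : ℝ} (hq0 : 0 < q) (hq1 : q < 1) {ρ : ℝ → ℝ} {f g : Polynomial ℝ}
    (hSumF : ∀ P : Polynomial ℝ,
      Summable fun n : ℤ => |q ^ n * ρ (q ^ n) * f.eval (q ^ n) * P.eval (q ^ n)|)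
    (hSumG : ∀ P : Polynomial ℝ,
      Summable fun n : ℤ => |q ^ n * ρ (q ^ n) * g.eval (q ^ n) * P.eval (q ^ n)|)
    (φ ψ : Polynomial ℝ) :
    Summable fun n : ℤ =>
      q ^ n * Aq q f.eval g.eval φ.eval (q ^ n) * ψ.eval (q ^ n) * ρ (q ^ n) := by
  obtain ⟨R, hR⟩ := exists_eval_mul_sub_eval_mul φ q⁻¹ q
  have hG := (hSumG (φ.comp (C q * X) * ψ)).of_abs.mul_left (Real.sqrt q)⁻¹
  have hF := (hSumF (R * ψ)).of_abs.mul_left (1 - q)⁻¹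
  refine (hG.add hF).congr fun n => ?_
  have hx : q ^ n ≠ 0 := (zpow_pos hq0 n).ne'
  generalize q ^ n = x at hx ⊢
  have hq : q ≠ 0 := hq0.ne'
  have h1 : 1 - q ≠ 0 := (sub_pos.2 hq1).ne'
  have hRx : R.eval x = (φ.eval (x / q) - φ.eval (q * x)) / x := by
    rw [eq_div_iff hx, mul_comm, ← hR, div_eq_inv_mul]
  have hc : (1 - q⁻¹) = -(1 - q) / q := by field_simp; ring
  simp only [Aq, Dq, Dqinv, eval_mul, eval_comp, eval_C, eval_X, hRx, hc]
  field_simp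
  ring

/-- By the `q`-Pearson equation, a lattice term of `⟨A_q φ, ψ⟩` is a difference of two boundary
terms. -/
theorem mul_Aq_mul_eq {q x : ℝ} (hq0 : 0 < q) (hq1 : q < 1) (hx : x ≠ 0) {ρ f g : ℝ → ℝ}
    (hPearson : f (q * x) * ρ (q * x)
      = (f x - (Real.sqrt q)⁻¹ * (1 - q) * x * g x) * ρ x) (φ ψ : ℝ → ℝ) :
    x * Aq q f g φ x * ψ x * ρ x
      = (1 - q)⁻¹ * (f x * ρ x * (ψ x * φ (x / q)) - f (q * x) * ρ (q * x) * (φ (q * x) * ψ x)) := by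
  have hq : q ≠ 0 := hq0.ne'
  have h1 : 1 - q ≠ 0 := (sub_pos.2 hq1).ne'
  have hc : (1 - q⁻¹) = -(1 - q) / q := by field_simp; ring
  rw [hPearson]
  simp only [Aq, Dq, Dqinv, hc]
  field_simp
  ring

/-- `A_q` is anti-self-adjoint for the symmetric inner product with
weight `ρ` on the exponential lattice. -/
theorem q_Aq_antiselfadjoint
    (q : ℝ) (hq0 : 0 < q) (hq1 : q < 1)
    (ρ : ℝ → ℝ) (hρ : ∀ n : ℤ, 0 ≤ ρ (q ^ n)) (f g : Polynomial ℝ)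
    (hPearson : ∀ n : ℤ,
      f.eval (q * q ^ n) * ρ (q * q ^ n)
        = (f.eval (q ^ n) - (Real.sqrt q)⁻¹ * (1 - q) * q ^ n * g.eval (q ^ n)) * ρ (q ^ n))
    (hSumF : ∀ P : Polynomial ℝ,
      Summable fun n : ℤ => |q ^ n * ρ (q ^ n) * f.eval (q ^ n) * P.eval (q ^ n)|)
    (hSumG : ∀ P : Polynomial ℝ,
      Summable fun n : ℤ => |q ^ n * ρ (q ^ n) * g.eval (q ^ n) * P.eval (q ^ n)|)
    (hSumρ : ∀ P : Polynomial ℝ,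
      Summable fun n : ℤ => |q ^ n * ρ (q ^ n) * P.eval (q ^ n)|)
    (hTendTop : ∀ P : Polynomial ℝ,
      Tendsto (fun n : ℤ => f.eval (q ^ n) * ρ (q ^ n) * P.eval (q ^ n)) atTop (nhds 0))
    (hTendBot : ∀ P : Polynomial ℝ,
      Tendsto (fun n : ℤ => f.eval (q ^ n) * ρ (q ^ n) * P.eval (q ^ n)) atBot (nhds 0))
    (φ ψ : Polynomial ℝ) :
    qIP q ρ (Aq q f.eval g.eval φ.eval) ψ.eval
      = - qIP q ρ φ.eval (Aq q f.eval g.eval ψ.eval) := by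
  have hS := summable_mul_Aq_mul hq0 hq1 hSumF hSumG
  have hterm (φ ψ : Polynomial ℝ) (n : ℤ) :=
    mul_Aq_mul_eq (f := f.eval) (g := g.eval) (ρ := ρ) hq0 hq1 (zpow_pos hq0 n).ne' (hPearson n)
      φ.eval ψ.eval
  let P : Polynomial ℝ := ψ * φ.comp (C q⁻¹ * X) + φ * ψ.comp (C q⁻¹ * X)
  let W : ℤ → ℝ := fun n => (1 - q)⁻¹ * (f.eval (q ^ n) * ρ (q ^ n) * P.eval (q ^ n))
  have hW (n : ℤ) :
      q ^ n * Aq q f.eval g.eval φ.eval (q ^ n) * ψ.eval (q ^ n) * ρ (q ^ n)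
        + q ^ n * Aq q f.eval g.eval ψ.eval (q ^ n) * φ.eval (q ^ n) * ρ (q ^ n)
        = W n - W (n + 1) := by
    have hq : q ≠ 0 := hq0.ne'
    rw [hterm φ ψ n, hterm ψ φ n]
    simp only [W, P, zpow_add_one₀ hq, mul_comm (q ^ n) q, eval_add, eval_mul, eval_comp, eval_C,
      eval_X, inv_mul_cancel_left₀ hq, div_eq_inv_mul]
    ring
  have hzero : ∑' n : ℤ, (W n - W (n + 1)) = 0 := by
    refine tsum_int_sub_succ_eq_zero (((hS φ ψ).add (hS ψ φ)).congr hW) ?_ ?_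
    · simpa using (hTendTop P).const_mul (1 - q)⁻¹
    · simpa using (hTendBot P).const_mul (1 - q)⁻¹
  rw [← tsum_congr hW, (hS φ ψ).tsum_add (hS ψ φ)] at hzero
  have hcomm : ∑' n : ℤ, q ^ n * φ.eval (q ^ n) * Aq q f.eval g.eval ψ.eval (q ^ n) * ρ (q ^ n)
      = ∑' n : ℤ, q ^ n * Aq q f.eval g.eval ψ.eval (q ^ n) * φ.eval (q ^ n) * ρ (q ^ n) :=
    tsum_congr fun n => by ring
  rw [qIP, qIP, hcomm, eq_neg_of_add_eq_zero_left hzero, mul_neg]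
end

section
/- For all real polynomial functions φ and ψ, one has ⟨φ, A_q ψ⟩ = ⟨φ, ψ⟩_{s,ω}, where ω(x) = f(qx)ρ(qx); that is, pairing with A_q converts the symmetric inner product with weight ρ into the skew-symmetric q-inner product with weight f(qx)ρ(qx). -/
open Polynomial Filter

/-- A telescoping series over `ℤ` that is summable and whose primitive vanishes at both ends
has sum zero. -/
lemma tsum_int_telescope_eq_zero {b : ℤ → ℝ} (hs : Summable fun n : ℤ => b (n + 1) - b n)
    (hTop : Tendsto b atTop (nhds 0)) (hBot : Tendsto b atBot (nhds 0)) :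
    ∑' n : ℤ, (b (n + 1) - b n) = 0 := by
  have hpos : Summable fun n : ℕ => b ((n : ℤ) + 1) - b n :=
    hs.comp_injective Nat.cast_injective
  have hneg : Summable fun n : ℕ => b (-((n : ℤ) + 1) + 1) - b (-((n : ℤ) + 1)) :=
    hs.comp_injective (i := fun n : ℕ => -((n : ℤ) + 1)) fun m n h => by
      simpa using h
  have hcast : Tendsto (fun n : ℕ => (n : ℤ)) atTop atTop := tendsto_natCast_atTop_atTop
  have hposSum : ∑' n : ℕ, (b ((n : ℤ) + 1) - b n) = -b 0 := by
    refine tendsto_nhds_unique hpos.hasSum.tendsto_sum_nat ?_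
    have h : ∀ N : ℕ, ∑ n ∈ Finset.range N, (b ((n : ℤ) + 1) - b n) = b N - b 0 := fun N => by
      simpa using Finset.sum_range_sub (fun n : ℕ => b n) N
    simpa only [h, zero_sub, Function.comp_def] using (hTop.comp hcast).sub_const (b 0)
  have hnegSum : ∑' n : ℕ, (b (-((n : ℤ) + 1) + 1) - b (-((n : ℤ) + 1))) = b 0 := by
    refine tendsto_nhds_unique hneg.hasSum.tendsto_sum_nat ?_
    have h : ∀ N : ℕ, ∑ n ∈ Finset.range N, (b (-((n : ℤ) + 1) + 1) - b (-((n : ℤ) + 1)))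
        = b 0 - b (-(N : ℤ)) := fun N => by
      simpa using Finset.sum_range_sub' (fun n : ℕ => b (-(n : ℤ))) N
    simpa only [h, sub_zero, Function.comp_def] using
      (hBot.comp (tendsto_neg_atTop_atBot.comp hcast)).const_sub (b 0)
  rw [tsum_of_nat_of_neg_add_one (f := fun n : ℤ => b (n + 1) - b n) hpos hneg, hposSum, hnegSum,
    neg_add_cancel]

/-- The difference of a polynomial and its dilation is divisible by the variable. -/
lemma exists_eval_sub_eval_mul_eq (P : Polynomial ℝ) (c : ℝ) :
    ∃ Q : Polynomial ℝ, ∀ x : ℝ, P.eval x - P.eval (c * x) = x * Q.eval x := by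
  obtain ⟨Q, hQ⟩ : (X : Polynomial ℝ) ∣ P - P.comp (C c * X) := by
    rw [X_dvd_iff, coeff_zero_eq_eval_zero]
    simp
  refine ⟨Q, fun x => ?_⟩
  simpa using congrArg (eval x) hQ

/-- pairing with `A_q` turns the symmetric inner product with weight `ρ`
into the skew-symmetric `q`-inner product with weight `ω(x) = f(qx)ρ(qx)`. -/
theorem q_Aq_skew_symmetrisation
    (q : ℝ) (hq0 : 0 < q) (hq1 : q < 1)
    (ρ : ℝ → ℝ) (hρ : ∀ n : ℤ, 0 ≤ ρ (q ^ n)) (f g : Polynomial ℝ)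
    (hPearson : ∀ n : ℤ,
      f.eval (q * q ^ n) * ρ (q * q ^ n)
        = (f.eval (q ^ n) - (Real.sqrt q)⁻¹ * (1 - q) * q ^ n * g.eval (q ^ n)) * ρ (q ^ n))
    (hSumF : ∀ P : Polynomial ℝ,
      Summable fun n : ℤ => |q ^ n * ρ (q ^ n) * f.eval (q ^ n) * P.eval (q ^ n)|)
    (hSumG : ∀ P : Polynomial ℝ,
      Summable fun n : ℤ => |q ^ n * ρ (q ^ n) * g.eval (q ^ n) * P.eval (q ^ n)|)
    (hSumρ : ∀ P : Polynomial ℝ,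
      Summable fun n : ℤ => |q ^ n * ρ (q ^ n) * P.eval (q ^ n)|)
    (hTendTop : ∀ P : Polynomial ℝ,
      Tendsto (fun n : ℤ => f.eval (q ^ n) * ρ (q ^ n) * P.eval (q ^ n)) atTop (nhds 0))
    (hTendBot : ∀ P : Polynomial ℝ,
      Tendsto (fun n : ℤ => f.eval (q ^ n) * ρ (q ^ n) * P.eval (q ^ n)) atBot (nhds 0))
    (φ ψ : Polynomial ℝ) :
    qIP q ρ φ.eval (Aq q f.eval g.eval ψ.eval)
      = qSIP q (fun x : ℝ => f.eval (q * x) * ρ (q * x)) φ.eval ψ.eval := by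
  have hw : 1 - q ≠ 0 := by linarith
  have hq : q ≠ 0 := hq0.ne'
  have hx : ∀ n : ℤ, q ^ n ≠ 0 := fun n => zpow_ne_zero n hq
  obtain ⟨Qφ, hQφ⟩ := exists_eval_sub_eval_mul_eq φ q
  obtain ⟨Qψ, hQψ⟩ := exists_eval_sub_eval_mul_eq ψ q
  obtain ⟨Rψ, hRψ⟩ := exists_eval_sub_eval_mul_eq ψ q⁻¹
  have hDψ : ∀ n : ℤ, Dq q ψ.eval (q ^ n) = (1 - q)⁻¹ * Qψ.eval (q ^ n) := fun n => by
    have := hx n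
    rw [Dq, hQψ]
    field_simp
  have hDφ : ∀ n : ℤ, Dq q φ.eval (q ^ n) = (1 - q)⁻¹ * Qφ.eval (q ^ n) := fun n => by
    have := hx n
    rw [Dq, hQφ]
    field_simp
  have hDinv : ∀ n : ℤ, Dqinv q ψ.eval (q ^ n) = (1 - q⁻¹)⁻¹ * Rψ.eval (q ^ n) := fun n => by
    rw [Dqinv, div_eq_inv_mul (q ^ n) q, hRψ, mul_comm (1 - q⁻¹), mul_div_mul_left _ _ (hx n),
      div_eq_inv_mul]
  have hL : Summable fun n : ℤ =>
      q ^ n * φ.eval (q ^ n) * Aq q f.eval g.eval ψ.eval (q ^ n) * ρ (q ^ n) := by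
    refine ((hSumG (φ * (C (Real.sqrt q)⁻¹ * ψ.comp (C q * X)))).of_abs.add
      (hSumF (φ * (C (q⁻¹ * (1 - q⁻¹)⁻¹) * Rψ + C (1 - q)⁻¹ * Qψ))).of_abs).congr fun n => ?_
    simp only [Aq, hDψ, hDinv, eval_mul, eval_add, eval_C, eval_comp, eval_X]
    ring
  have hR : Summable fun n : ℤ =>
      q ^ n * (φ.eval (q ^ n) * Dq q ψ.eval (q ^ n) - ψ.eval (q ^ n) * Dq q φ.eval (q ^ n))
        * (f.eval (q * q ^ n) * ρ (q * q ^ n)) := by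
    refine ((hSumF (C (1 - q)⁻¹ * (φ * Qψ - ψ * Qφ))).of_abs.sub
      (hSumG (C ((Real.sqrt q)⁻¹ * (1 - q)) * X * (C (1 - q)⁻¹ * (φ * Qψ - ψ * Qφ)))).of_abs).congr
        fun n => ?_
    simp only [hPearson, hDψ, hDφ, eval_mul, eval_sub, eval_C, eval_X]
    ring
  let b : ℤ → ℝ := fun n =>
    f.eval (q ^ n) * ρ (q ^ n) * (C (1 - q)⁻¹ * φ * ψ.comp (C q⁻¹ * X)).eval (q ^ n)
  have hb : ∀ n : ℤ,
      q ^ n * (φ.eval (q ^ n) * Dq q ψ.eval (q ^ n) - ψ.eval (q ^ n) * Dq q φ.eval (q ^ n))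
          * (f.eval (q * q ^ n) * ρ (q * q ^ n))
        - q ^ n * φ.eval (q ^ n) * Aq q f.eval g.eval ψ.eval (q ^ n) * ρ (q ^ n)
      = b (n + 1) - b n := fun n => by
    have hsucc : q ^ (n + 1) = q * q ^ n := by rw [zpow_add_one₀ hq, mul_comm]
    have hinv : q⁻¹ * (q * q ^ n) = q ^ n := inv_mul_cancel_left₀ hq _
    have hxDψ : q ^ n * Dq q ψ.eval (q ^ n)
        = (1 - q)⁻¹ * (ψ.eval (q ^ n) - ψ.eval (q * q ^ n)) := by
      rw [hDψ, hQψ]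
      ring
    have hxDφ : q ^ n * Dq q φ.eval (q ^ n)
        = (1 - q)⁻¹ * (φ.eval (q ^ n) - φ.eval (q * q ^ n)) := by
      rw [hDφ, hQφ]
      ring
    have hcoef : q⁻¹ * (1 - q⁻¹)⁻¹ = -(1 - q)⁻¹ := by
      rw [← mul_inv, mul_sub, mul_inv_cancel₀ hq, mul_one, ← inv_neg, neg_sub]
    have hxDinv : q ^ n * (q⁻¹ * Dqinv q ψ.eval (q ^ n))
        = -(1 - q)⁻¹ * (ψ.eval (q ^ n) - ψ.eval (q⁻¹ * q ^ n)) := by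
      rw [hDinv, hRψ, ← hcoef]
      ring
    simp only [b, hsucc, eval_mul, eval_C, eval_comp, eval_X, hinv, Aq, hPearson]
    linear_combination
      (φ.eval (q ^ n) * (f.eval (q ^ n) - (Real.sqrt q)⁻¹ * (1 - q) * q ^ n * g.eval (q ^ n))
        * ρ (q ^ n) - φ.eval (q ^ n) * f.eval (q ^ n) * ρ (q ^ n)) * hxDψ
      - ψ.eval (q ^ n) * (f.eval (q ^ n) - (Real.sqrt q)⁻¹ * (1 - q) * q ^ n * g.eval (q ^ n))
        * ρ (q ^ n) * hxDφ
      - φ.eval (q ^ n) * f.eval (q ^ n) * ρ (q ^ n) * hxDinv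
      + φ.eval (q ^ n) * (Real.sqrt q)⁻¹ * q ^ n * g.eval (q ^ n) * ψ.eval (q * q ^ n)
        * ρ (q ^ n) * inv_mul_cancel₀ hw
  have htel := tsum_int_telescope_eq_zero (b := b) ((hR.sub hL).congr hb)
    (hTendTop _) (hTendBot _)
  rw [qIP, qSIP, eq_comm, ← sub_eq_zero, ← mul_sub, ← hR.tsum_sub hL, tsum_congr hb, htel, mul_zero]
end
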